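/- arXiv:2310.17828 — 2 statements merged into one kernel-verified Lean document; each statement's English description precedes it below -/
import Mathlib

section
/- Let l be an integer with 1 ≤ l ≤ d−1 and let γ ∈ {0,1}^d with ‖γ‖₁ = l. There exists a constant C > 0, depending only on d, such that for every measurable function f : (0,∞) → ℝ and every Δ ∈ (0,1], ∫_{B_γ(Δ)} |f(π²η‖z‖²)| dz ≤ C · Δ^{l/2} · ∫_{√Δ/2}^∞ r^{d−1−l} |f(π²η r²)| dr (an inequality in [0,∞]). -/
open MeasureTheory

/-- Integration in polar coordinates of a nonnegative radial function. -/
lemma lintegral_fun_norm_addHaar {E : Type*} [NormedAddCommGroup E] [NormedSpace ℝ E]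
    [MeasurableSpace E] [BorelSpace E] [FiniteDimensional ℝ E] [Nontrivial E]
    (μ : Measure E) [μ.IsAddHaarMeasure] {f : ℝ → ENNReal} (hf : Measurable f) :
    ∫⁻ x, f ‖x‖ ∂μ = μ.toSphere Set.univ *
      ∫⁻ r in Set.Ioi (0 : ℝ), ENNReal.ofReal (r ^ (Module.finrank ℝ E - 1)) * f r := by
  have hms : MeasurableSet ({0}ᶜ : Set E) := (measurableSet_singleton _).compl
  calc
    ∫⁻ x, f ‖x‖ ∂μ = ∫⁻ x : ({(0)}ᶜ : Set E), f ‖x.1‖ ∂(μ.comap (↑)) := by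
      rw [lintegral_subtype_comap hms fun x ↦ f ‖x‖, restrict_compl_singleton]
    _ = ∫⁻ x, f x.2 ∂μ.toSphere.prod (.volumeIoiPow (Module.finrank ℝ E - 1)) := by
      simpa using μ.measurePreserving_homeomorphUnitSphereProd.lintegral_comp
        (f := f ∘ Subtype.val ∘ Prod.snd)
        (hf.comp (measurable_subtype_coe.comp measurable_snd))
    _ = μ.toSphere Set.univ *
        ∫⁻ r : Set.Ioi (0 : ℝ), f r ∂.volumeIoiPow (Module.finrank ℝ E - 1) := by
      rw [lintegral_prod _ 
        (by fun_prop : Measurable fun x : Metric.sphere (0 : E) 1 × Set.Ioi (0 : ℝ) ↦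
          f x.2).aemeasurable]
      simp [mul_comm]
    _ = _ := by
      rw [Measure.volumeIoiPow, lintegral_withDensity_eq_lintegral_mul _
        (measurable_subtype_coe.pow_const _).ennreal_ofReal (by fun_prop : Measurable fun r : Set.Ioi (0 : ℝ) ↦ f r)]
      congr 1
      exact lintegral_subtype_comap measurableSet_Ioi
        fun r : ℝ ↦ ENNReal.ofReal (r ^ (Module.finrank ℝ E - 1)) * f r

/-- The substitution `s = √(X + r²)` changes a radial integral over `(a, ∞)` by at most the
factor `√(D + 1)` as long as `X ≤ D a²`. -/
lemma setLIntegral_Ioi_add_sq_le (n : ℕ) {a D X : ℝ} (ha : 0 < a) (hX : 0 ≤ X)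
    (hXD : X ≤ D * a ^ 2) (G : ℝ → ENNReal) :
    ∫⁻ r in Set.Ioi a, ENNReal.ofReal (r ^ n) * G (X + r ^ 2) ≤
      ENNReal.ofReal √(D + 1) * ∫⁻ s in Set.Ioi a, ENNReal.ofReal (s ^ n) * G (s ^ 2) := by
  have hpos : ∀ r ∈ Set.Ioi a, 0 < r := fun r hr ↦ ha.trans hr
  have hderiv : ∀ r ∈ Set.Ioi a, HasDerivWithinAt (fun r ↦ √(X + r ^ 2))
      (r / √(X + r ^ 2)) (Set.Ioi a) r := by
    intro r hr
    have hr0 := hpos r hr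
    have h : HasDerivAt (fun r ↦ X + r ^ 2) (2 * r) r := by
      simpa using (hasDerivAt_pow 2 r).const_add X
    have h' := h.sqrt (by positivity)
    rw [mul_div_mul_left _ _ two_ne_zero] at h'
    exact h'.hasDerivWithinAt
  have hinj : Set.InjOn (fun r ↦ √(X + r ^ 2)) (Set.Ioi a) := by
    intro r hr s hs h
    have hr0 := hpos r hr
    have hs0 := hpos s hs
    have h' := (Real.sqrt_inj (by positivity) (by positivity)).1 h
    exact (pow_left_inj₀ hr0.le hs0.le two_ne_zero).1 (by linarith)
  have hle : ∀ r ∈ Set.Ioi a, r ≤ √(X + r ^ 2) := fun r hr ↦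
    Real.le_sqrt_of_sq_le (by linarith)
  have himage : (fun r ↦ √(X + r ^ 2)) '' Set.Ioi a ⊆ Set.Ioi a := by
    rintro _ ⟨r, hr, rfl⟩
    exact lt_of_lt_of_le hr (hle r hr)
  have hcov := lintegral_image_eq_lintegral_abs_deriv_mul measurableSet_Ioi hderiv hinj
    fun s ↦ ENNReal.ofReal (s ^ n) * G (s ^ 2)
  refine le_trans ?_ (mul_le_mul_right (lintegral_mono_set himage) _)
  rw [hcov, ← lintegral_const_mul' _ _ ENNReal.ofReal_ne_top]
  refine setLIntegral_mono' measurableSet_Ioi fun r hr ↦ ?_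
  have hr0 := hpos r hr
  have hφ : 0 < √(X + r ^ 2) := hr0.trans_le (hle r hr)
  rw [Real.sq_sqrt (by positivity), ← mul_assoc, ← mul_assoc,
    ← ENNReal.ofReal_mul (by positivity), ← ENNReal.ofReal_mul (by positivity)]
  gcongr
  rw [abs_of_pos (by positivity)]
  have hD : 0 ≤ D := by
    by_contra! h
    nlinarith [sq_pos_of_pos ha]
  have hbound : √(X + r ^ 2) ≤ √(D + 1) * r := by
    rw [← Real.sqrt_sq hr0.le, ← Real.sqrt_mul (by positivity), Real.sqrt_sq hr0.le]
    apply Real.sqrt_le_sqrt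
    have : a ^ 2 ≤ r ^ 2 := pow_le_pow_left₀ ha.le (le_of_lt hr) 2
    nlinarith
  have hone : 1 ≤ √(D + 1) * (r / √(X + r ^ 2)) := by
    rw [← mul_div_assoc, one_le_div hφ]
    exact hbound
  calc r ^ n = 1 * r ^ n := (one_mul _).symm
    _ ≤ √(D + 1) * (r / √(X + r ^ 2)) * √(X + r ^ 2) ^ n := by
      gcongr
      exact hle r hr

/-- A radial integral over the orthant `[a, ∞)^ι`, with the squared radius shifted by `X ≤ D a²`,
is controlled by a one-dimensional integral over `(a, ∞)`. -/
lemma setLIntegral_Ici_add_sum_sq_le {ι : Type*} [Fintype ι] [Nonempty ι] {a D X : ℝ}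
    (ha : 0 < a) (hX : 0 ≤ X) (hXD : X ≤ D * a ^ 2) {G : ℝ → ENNReal} (hG : Measurable G) :
    ∫⁻ y in {y : ι → ℝ | ∀ i, a ≤ y i}, G (X + ∑ i, y i ^ 2) ≤
      (volume : Measure (EuclideanSpace ℝ ι)).toSphere Set.univ * ENNReal.ofReal √(D + 1) *
        ∫⁻ r in Set.Ioi a, ENNReal.ofReal (r ^ (Fintype.card ι - 1)) * G (r ^ 2) := by
  set F : ℝ → ENNReal := (Set.Ici a).indicator fun r ↦ G (X + r ^ 2) with hF
  have hFm : Measurable F :=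
    (hG.comp ((measurable_id.pow_const 2).const_add X)).indicator measurableSet_Ici
  have hS : MeasurableSet {y : ι → ℝ | ∀ i, a ≤ y i} := by
    simp only [Set.ofPred_forall]
    exact MeasurableSet.iInter fun i ↦ measurableSet_le measurable_const (measurable_pi_apply i)
  have hnorm : ∀ y : ι → ℝ, ‖WithLp.toLp 2 y‖ ^ 2 = ∑ i, y i ^ 2 := fun y ↦ by
    simp [EuclideanSpace.norm_sq_eq]
  have hpolar : ∫⁻ y in {y : ι → ℝ | ∀ i, a ≤ y i}, G (X + ∑ i, y i ^ 2) ≤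
      ∫⁻ y : EuclideanSpace ℝ ι, F ‖y‖ := by
    rw [← (PiLp.volume_preserving_toLp ι).lintegral_comp
      (by fun_prop : Measurable fun y : EuclideanSpace ℝ ι ↦ F ‖y‖)]
    refine (setLIntegral_mono' hS fun y hy ↦ ?_).trans (setLIntegral_le_lintegral _ _)
    obtain ⟨i⟩ := ‹Nonempty ι›
    have hay : a ≤ ‖WithLp.toLp 2 y‖ := (hy i).trans <| (le_abs_self _).trans <|
      PiLp.norm_apply_le (WithLp.toLp 2 y) i
    rw [hF, Set.indicator_of_mem (Set.mem_Ici.2 hay), hnorm]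
  refine hpolar.trans ?_
  rw [lintegral_fun_norm_addHaar _ hFm, finrank_euclideanSpace, mul_assoc]
  gcongr
  refine le_trans (le_of_eq ?_) (setLIntegral_Ioi_add_sq_le _ ha hX hXD G)
  rw [← lintegral_indicator measurableSet_Ioi, ← setLIntegral_congr Ioi_ae_eq_Ici.symm,
    ← lintegral_indicator measurableSet_Ici]
  refine lintegral_congr fun r ↦ ?_
  by_cases hr : a ≤ r
  · simp [hF, hr, ha.trans_le hr]
  · simp [hF, hr]

/-- The integral of a radial function over a product of `[0, a)` in the coordinates satisfying `p`
and `[a, ∞)` in the others is controlled by a one-dimensional integral over `(a, ∞)`. -/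
lemma setLIntegral_mixed_box_sum_sq_le {ι : Type*} [Fintype ι] (p : ι → Prop) [DecidablePred p]
    [Nonempty {i // ¬ p i}] {a : ℝ} (ha : 0 < a) {G : ℝ → ENNReal} (hG : Measurable G) :
    ∫⁻ z in {z : ι → ℝ | ∀ i, (p i → 0 ≤ z i ∧ z i < a) ∧ (¬ p i → a ≤ z i)}, G (∑ i, z i ^ 2) ≤
      (volume : Measure (EuclideanSpace ℝ {i // ¬ p i})).toSphere Set.univ *
        ENNReal.ofReal √(Fintype.card {i // p i} + 1) *
        (∫⁻ r in Set.Ioi a, ENNReal.ofReal (r ^ (Fintype.card {i // ¬ p i} - 1)) * G (r ^ 2)) *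
        ENNReal.ofReal (a ^ Fintype.card {i // p i}) := by
  set S : Set ({i // p i} → ℝ) := Set.univ.pi fun _ ↦ Set.Ico 0 a
  set T : Set ({i // ¬ p i} → ℝ) := {y | ∀ i, a ≤ y i}
  have hS : MeasurableSet S := MeasurableSet.univ_pi fun _ ↦ measurableSet_Ico
  have hvol : volume S = ENNReal.ofReal (a ^ Fintype.card {i // p i}) := by
    simp [S, Real.volume_pi_Ico, ENNReal.ofReal_pow ha.le]
  have hset : {z : ι → ℝ | ∀ i, (p i → 0 ≤ z i ∧ z i < a) ∧ (¬ p i → a ≤ z i)} =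
      MeasurableEquiv.piEquivPiSubtypeProd (fun _ ↦ ℝ) p ⁻¹' (S ×ˢ T) := by
    ext z
    simp [S, T, MeasurableEquiv.piEquivPiSubtypeProd, Equiv.piEquivPiSubtypeProd, forall_and]
  have hsum : ∀ z : ι → ℝ, ∑ i, z i ^ 2 =
      (fun w : ({i // p i} → ℝ) × ({i // ¬ p i} → ℝ) ↦ ∑ i, w.1 i ^ 2 + ∑ i, w.2 i ^ 2)
        (MeasurableEquiv.piEquivPiSubtypeProd (fun _ ↦ ℝ) p z) := fun z ↦
    (Fintype.sum_subtype_add_sum_subtype p fun i ↦ z i ^ 2).symm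
  simp_rw [hset, hsum]
  rw [(volume_preserving_piEquivPiSubtypeProd (fun _ ↦ ℝ) p).setLIntegral_comp_preimage_emb
    (MeasurableEquiv.measurableEmbedding _) (fun w ↦ G (∑ i, w.1 i ^ 2 + ∑ i, w.2 i ^ 2)),
    Measure.volume_eq_prod, setLIntegral_prod _ (by fun_prop), ← hvol, ← setLIntegral_const]
  refine setLIntegral_mono' hS fun x hx ↦ ?_
  refine setLIntegral_Ici_add_sum_sq_le (X := ∑ i, x i ^ 2) ha (by positivity) ?_ hG
  calc ∑ i, x i ^ 2 ≤ ∑ _i : {i // p i}, a ^ 2 := Finset.sum_le_sum fun i _ ↦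
        pow_le_pow_left₀ (hx i trivial).1 (hx i trivial).2.le 2
    _ = Fintype.card {i // p i} * a ^ 2 := by simp

/-- there is a constant `C > 0` depending only on `d` such that for every
`1 ≤ l ≤ d−1`, every `γ ∈ {0,1}^d` with `‖γ‖₁ = l`, every measurable `f : (0,∞) → ℝ`
and every `Δ ∈ (0,1]`,
`∫_{B_γ(Δ)} |f(π²η‖z‖²)| dz ≤ C Δ^{l/2} ∫_{√Δ/2}^∞ r^{d−1−l} |f(π²η r²)| dr` in `[0,∞]`. -/
theorem stmt11 (d : ℕ) (hd : 2 ≤ d) (η : ℝ) (hη : 0 < η) :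
    ∃ C : ℝ, 0 < C ∧ ∀ l : ℕ, 1 ≤ l → l ≤ d - 1 → ∀ γ : Fin d → Bool,
      (Finset.univ.filter fun i => γ i = true).card = l →
      ∀ f : ℝ → ℝ, Measurable f → ∀ Δ ∈ Set.Ioc (0 : ℝ) 1,
        (∫⁻ z in {x : Fin d → ℝ | ∀ i,
            (γ i = true → 0 ≤ x i ∧ x i < Real.sqrt Δ / 2) ∧
              (γ i = false → Real.sqrt Δ / 2 ≤ x i)},
          ENNReal.ofReal |f (Real.pi ^ 2 * η * ∑ i, z i ^ 2)|) ≤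
        ENNReal.ofReal (C * Δ ^ ((l : ℝ) / 2)) *
          ∫⁻ r in Set.Ioi (Real.sqrt Δ / 2),
            ENNReal.ofReal (r ^ (d - 1 - l) * |f (Real.pi ^ 2 * η * r ^ 2)|) := by
  set K : (Fin d → Bool) → ℝ := fun γ ↦
    (volume : Measure (EuclideanSpace ℝ {i // ¬ γ i = true})).toSphere.real Set.univ * √(d + 1)
    with hK
  have hK0 : ∀ γ, 0 ≤ K γ := fun γ ↦ by positivity
  refine ⟨∑ γ, K γ + 1, by positivity, ?_⟩
  intro l _ hld γ hγ f hf Δ ⟨hΔ, _⟩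
  have hcard : Fintype.card {i // γ i = true} = l := by rw [Fintype.card_subtype, hγ]
  have hcard' : Fintype.card {i // ¬ γ i = true} = d - l := by
    rw [Fintype.card_subtype_compl, hcard, Fintype.card_fin]
  have : Nonempty {i // ¬ γ i = true} := Fintype.card_pos_iff.1 (by omega)
  have hsqrt : 0 < √Δ := Real.sqrt_pos.2 hΔ
  have hG : Measurable fun s ↦ ENNReal.ofReal |f (Real.pi ^ 2 * η * s)| := by fun_prop
  have hmain := setLIntegral_mixed_box_sum_sq_le (fun i ↦ γ i = true) (half_pos hsqrt) hG
  rw [hcard, hcard'] at hmain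
  simp only [Bool.not_eq_true] at hmain
  refine hmain.trans ?_
  have hint : ∫⁻ r in Set.Ioi (√Δ / 2), ENNReal.ofReal (r ^ (d - l - 1)) *
        ENNReal.ofReal |f (Real.pi ^ 2 * η * r ^ 2)| =
      ∫⁻ r in Set.Ioi (√Δ / 2),
        ENNReal.ofReal (r ^ (d - 1 - l) * |f (Real.pi ^ 2 * η * r ^ 2)|) := by
    refine setLIntegral_congr_fun measurableSet_Ioi fun r hr ↦ ?_
    have hr0 : 0 < r := (half_pos hsqrt).trans hr
    rw [← ENNReal.ofReal_mul (by positivity), Nat.sub_right_comm]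
  rw [hint, mul_right_comm]
  gcongr
  rw [← ofReal_measureReal (measure_ne_top _ _), ← ENNReal.ofReal_mul (by positivity), ← ENNReal.ofReal_mul (by positivity)]
  apply ENNReal.ofReal_le_ofReal
  have hpow : Δ ^ ((l : ℝ) / 2) = √Δ ^ l := by
    rw [Real.sqrt_eq_rpow, ← Real.rpow_natCast, ← Real.rpow_mul hΔ.le]
    congr 1
    ring
  have hKγ : K γ ≤ ∑ γ, K γ + 1 :=
    (Finset.single_le_sum (fun γ _ ↦ hK0 γ) (Finset.mem_univ γ)).trans (by linarith)
  rw [hpow]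
  refine mul_le_mul (le_trans ?_ hKγ) ?_ (by positivity) (by positivity)
  · simp only [hK]
    gcongr
    omega
  · gcongr
    linarith
end

section
/- Assume −ϑ0 + Σ_{l=1}^d ν_l²/(4η) + π²ηd > 0, so that λ_k > 0 for every multi-index k of positive integers. Let α' ∈ (0,1) and α := d/2 − 1 + α'. Then there exist constants C > 0 and Δ₀ ∈ (0,1) such that for every Δ ∈ (0,Δ₀], | Δ^{d/2} Σ_{k ∈ (ℕ_{≥1})^d} f_α(λ_k Δ) − Γ(1−α')/(2^{d}(πη)^{d/2} α' Γ(d/2)) + Σ_{γ ∈ {0,1}^d, 1 ≤ ‖γ‖₁ ≤ d−1} ∫_{B_γ(Δ)} f_α(π²η‖z‖²) dz | ≤ C · Δ^{1−α'}. -/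
open MeasureTheory

/-- The function `x ↦ (1 - e⁻ˣ) / x ^ p`. -/
noncomputable def expQuot (p x : ℝ) : ℝ := (1 - Real.exp (-x)) / x ^ p

/-- The derivative of `expQuot p` on the positive half-line. -/
noncomputable def expQuotDeriv (p x : ℝ) : ℝ :=
  Real.exp (-x) * x ^ (-p) + (1 - Real.exp (-x)) * (-p * x ^ (-p - 1))

/-- The second derivative of `expQuot p` on the positive half-line. -/
noncomputable def expQuotDerivTwo (p x : ℝ) : ℝ :=
  -Real.exp (-x) * x ^ (-p) + 2 * (Real.exp (-x) * (-p * x ^ (-p - 1)))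
    + (1 - Real.exp (-x)) * (-p * ((-p - 1) * x ^ (-p - 1 - 1)))

lemma hasDerivAt_exp_neg (x : ℝ) :
    HasDerivAt (fun y : ℝ => Real.exp (-y)) (-Real.exp (-x)) x := by
  simpa using (hasDerivAt_neg x).exp

lemma one_sub_exp_neg_nonneg {x : ℝ} (hx : 0 ≤ x) : 0 ≤ 1 - Real.exp (-x) := by
  have := Real.exp_le_one_iff.2 (neg_nonpos.2 hx)
  linarith

lemma one_sub_exp_neg_le (x : ℝ) : 1 - Real.exp (-x) ≤ x := by
  have := Real.add_one_le_exp (-x)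
  linarith

lemma expQuot_nonneg (p : ℝ) {x : ℝ} (hx : 0 ≤ x) : 0 ≤ expQuot p x :=
  div_nonneg (one_sub_exp_neg_nonneg hx) (Real.rpow_nonneg hx _)

lemma expQuot_eq_mul (p : ℝ) {x : ℝ} (hx : 0 ≤ x) :
    expQuot p x = (1 - Real.exp (-x)) * x ^ (-p) := by
  rw [expQuot, Real.rpow_neg hx, div_eq_mul_inv]

lemma measurable_expQuot (p : ℝ) : Measurable (expQuot p) := by
  unfold expQuot
  fun_prop

lemma hasDerivAt_expQuot (p : ℝ) {x : ℝ} (hx : 0 < x) :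
    HasDerivAt (expQuot p) (expQuotDeriv p x) x := by
  have h := ((hasDerivAt_exp_neg x).const_sub 1).mul
    (Real.hasDerivAt_rpow_const (p := -p) (Or.inl hx.ne'))
  have h' := h.congr_of_eventuallyEq (f₁ := expQuot p) (by
    filter_upwards [lt_mem_nhds hx] with y hy
    exact expQuot_eq_mul p hy.le)
  exact h'.congr_deriv (by rw [neg_neg, expQuotDeriv])

lemma hasDerivAt_expQuotDeriv (p : ℝ) {x : ℝ} (hx : 0 < x) :
    HasDerivAt (expQuotDeriv p) (expQuotDerivTwo p x) x := by
  have h := ((hasDerivAt_exp_neg x).mul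
    (Real.hasDerivAt_rpow_const (p := -p) (Or.inl hx.ne'))).add
      (((hasDerivAt_exp_neg x).const_sub 1).mul
        ((Real.hasDerivAt_rpow_const (p := -p - 1) (Or.inl hx.ne')).const_mul (-p)))
  convert! h using 1
  simp only [expQuotDerivTwo]
  ring

lemma abs_expQuotDeriv_le {p : ℝ} (hp : 0 < p) {x : ℝ} (hx : 0 < x) :
    |expQuotDeriv p x| ≤ (1 + p) * x ^ (-p) := by
  have e1 : Real.exp (-x) ≤ 1 := Real.exp_le_one_iff.2 (by linarith)
  have e0 := Real.exp_pos (-x)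
  have e2 := one_sub_exp_neg_le x
  have e3 := one_sub_exp_neg_nonneg hx.le
  have hr : x ^ (-p) = x ^ (-p - 1) * x := by
    rw [← Real.rpow_add_one hx.ne']; ring_nf
  have hq : 0 < x ^ (-p - 1) := Real.rpow_pos_of_pos hx _
  have h1 : Real.exp (-x) * x ^ (-p) ≤ x ^ (-p) :=
    mul_le_of_le_one_left (by positivity) e1
  have h0 : 0 ≤ Real.exp (-x) * x ^ (-p) := by positivity
  have h2 : (1 - Real.exp (-x)) * (p * x ^ (-p - 1)) ≤ p * x ^ (-p) := by
    rw [hr]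
    calc _ ≤ x * (p * x ^ (-p - 1)) := by gcongr
      _ = _ := by ring
  have h3 : 0 ≤ (1 - Real.exp (-x)) * (p * x ^ (-p - 1)) := by positivity
  have : 0 < x ^ (-p) := by positivity
  rw [expQuotDeriv, abs_le]
  constructor <;> nlinarith

lemma abs_expQuotDerivTwo_le {p : ℝ} (hp : 0 < p) {x : ℝ} (hx : 0 < x) :
    |expQuotDerivTwo p x| ≤ (1 + 2 * p + p * (p + 1)) * x ^ (-p - 1) := by
  have e1 : Real.exp (-x) ≤ 1 := Real.exp_le_one_iff.2 (by linarith)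
  have e0 := Real.exp_pos (-x)
  have e2 := one_sub_exp_neg_le x
  have e3 := one_sub_exp_neg_nonneg hx.le
  have hr : x ^ (-p) = x ^ (-p - 1) * x := by
    rw [← Real.rpow_add_one hx.ne']; ring_nf
  have hr' : x ^ (-p - 1) = x ^ (-p - 1 - 1) * x := by
    rw [← Real.rpow_add_one hx.ne']; ring_nf
  have hq : 0 < x ^ (-p - 1) := Real.rpow_pos_of_pos hx _
  have hq' : 0 < x ^ (-p - 1 - 1) := Real.rpow_pos_of_pos hx _
  have hxe : Real.exp (-x) * x ≤ 1 := by
    have := Real.add_one_le_exp x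
    rw [Real.exp_neg, inv_mul_le_one₀ (Real.exp_pos x)]
    linarith
  have h1 : Real.exp (-x) * x ^ (-p) ≤ x ^ (-p - 1) := by
    rw [hr]
    calc _ = (Real.exp (-x) * x) * x ^ (-p - 1) := by ring
      _ ≤ _ := mul_le_of_le_one_left hq.le hxe
  have h0 : 0 ≤ Real.exp (-x) * x ^ (-p) := by positivity
  have h2 : Real.exp (-x) * (p * x ^ (-p - 1)) ≤ p * x ^ (-p - 1) :=
    mul_le_of_le_one_left (by positivity) e1
  have h2' : 0 ≤ Real.exp (-x) * (p * x ^ (-p - 1)) := by positivity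
  have h3 : (1 - Real.exp (-x)) * (p * ((p + 1) * x ^ (-p - 1 - 1)))
      ≤ p * (p + 1) * x ^ (-p - 1) := by
    rw [hr']
    calc _ ≤ x * (p * ((p + 1) * x ^ (-p - 1 - 1))) := by gcongr
      _ = _ := by ring
  have h3' : 0 ≤ (1 - Real.exp (-x)) * (p * ((p + 1) * x ^ (-p - 1 - 1))) := by positivity
  have he : expQuotDerivTwo p x = -(Real.exp (-x) * x ^ (-p))
      - 2 * (Real.exp (-x) * (p * x ^ (-p - 1)))
      + (1 - Real.exp (-x)) * (p * ((p + 1) * x ^ (-p - 1 - 1))) := by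
    rw [expQuotDerivTwo]; ring
  rw [he, abs_le]
  constructor <;> nlinarith

lemma abs_expQuot_sub_le {p : ℝ} (hp : 0 < p) {b x y : ℝ} (hb : 0 < b) (hx : b ≤ x)
    (hy : b ≤ y) : |expQuot p y - expQuot p x| ≤ (1 + p) * b ^ (-p) * |y - x| := by
  refine Convex.norm_image_sub_le_of_norm_hasDerivWithin_le (s := Set.Ici b)
    (f' := expQuotDeriv p) (fun t ht => ?_) (fun t ht => ?_) (convex_Ici b) hx hy
  · exact (hasDerivAt_expQuot p (hb.trans_le ht)).hasDerivWithinAt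
  · refine (abs_expQuotDeriv_le hp (hb.trans_le ht)).trans ?_
    exact mul_le_mul_of_nonneg_left
      (Real.rpow_le_rpow_of_nonpos hb ht (by linarith)) (by linarith)

lemma abs_expQuot_sub_sub_le {p : ℝ} (hp : 0 < p) {b x y : ℝ} (hb : 0 < b) (hx : b ≤ x)
    (hy : b ≤ y) : |expQuot p y - expQuot p x - expQuotDeriv p x * (y - x)|
      ≤ (1 + 2 * p + p * (p + 1)) * b ^ (-p - 1) * (y - x) ^ 2 := by
  set M := (1 + 2 * p + p * (p + 1)) * b ^ (-p - 1) with hM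
  have hM0 : 0 ≤ M := by positivity
  have key : ∀ t ∈ Set.uIcc x y, |expQuotDeriv p t - expQuotDeriv p x| ≤ M * |y - x| := by
    intro t ht
    have hbt : b ≤ t := (le_min hx hy).trans ht.1
    have h := Convex.norm_image_sub_le_of_norm_hasDerivWithin_le (s := Set.Ici b)
      (f := expQuotDeriv p) (f' := expQuotDerivTwo p) (C := M) (x := x) (y := t)
      (fun t ht => (hasDerivAt_expQuotDeriv p (hb.trans_le ht)).hasDerivWithinAt)
      (fun t ht => by
        refine (abs_expQuotDerivTwo_le hp (hb.trans_le ht)).trans ?_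
        rw [hM]
        exact mul_le_mul_of_nonneg_left
          (Real.rpow_le_rpow_of_nonpos hb ht (by linarith)) (by positivity)) (convex_Ici b) hx hbt
    refine h.trans ?_
    gcongr
    exact Set.abs_sub_left_of_mem_uIcc ht
  have h := Convex.norm_image_sub_le_of_norm_hasDerivWithin_le (s := Set.uIcc x y)
    (f := fun t => expQuot p t - expQuotDeriv p x * t)
    (f' := fun t => expQuotDeriv p t - expQuotDeriv p x) (C := M * |y - x|) (x := x) (y := y)
    (fun t ht => by
      have hbt : b ≤ t := (le_min hx hy).trans ht.1
      have h1 := (hasDerivAt_expQuot p (hb.trans_le hbt)).sub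
        ((hasDerivAt_id t).const_mul (expQuotDeriv p x))
      rw [mul_one] at h1
      exact h1.hasDerivWithinAt)
    key (convex_uIcc x y) Set.left_mem_uIcc Set.right_mem_uIcc
  simp only [Real.norm_eq_abs] at h
  calc _ = |expQuot p y - expQuotDeriv p x * y - (expQuot p x - expQuotDeriv p x * x)| := by
        congr 1; ring
    _ ≤ _ := h
    _ = M * (y - x) ^ 2 := by rw [mul_assoc, abs_mul_abs_self]; ring

lemma integrableOn_one_sub_exp_mul_rpow {s : ℝ} (h0 : 0 < s) (h1 : s < 1) :
    IntegrableOn (fun x : ℝ => (1 - Real.exp (-x)) * x ^ (-s - 1)) (Set.Ioi 0) := by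
  have hm : Measurable (fun x : ℝ => (1 - Real.exp (-x)) * x ^ (-s - 1)) := by fun_prop
  rw [← Set.Ioc_union_Ioi_eq_Ioi (zero_le_one' ℝ), integrableOn_union]
  constructor
  · have hi : IntegrableOn (fun x : ℝ => x ^ (-s)) (Set.Ioc 0 1) := by
      rw [integrableOn_Ioc_iff_integrableOn_Ioo, intervalIntegral.integrableOn_Ioo_rpow_iff one_pos]
      linarith
    refine hi.mono' hm.aestronglyMeasurable ?_
    filter_upwards [ae_restrict_mem measurableSet_Ioc] with x hx
    have h3 := one_sub_exp_neg_nonneg hx.1.le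
    have hq : 0 ≤ x ^ (-s - 1) := Real.rpow_nonneg hx.1.le _
    rw [Real.norm_of_nonneg (mul_nonneg h3 hq)]
    calc _ ≤ x * x ^ (-s - 1) := by gcongr; exact one_sub_exp_neg_le x
      _ = x ^ (-s) := by rw [mul_comm, ← Real.rpow_add_one hx.1.ne']; ring_nf
  · refine (integrableOn_Ioi_rpow_of_lt (by linarith : -s - 1 < -1) one_pos).mono'
      hm.aestronglyMeasurable ?_
    filter_upwards [ae_restrict_mem measurableSet_Ioi] with x hx
    have hx0 : 0 < x := one_pos.trans hx
    have h3 := one_sub_exp_neg_nonneg hx0.le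
    have hq : 0 ≤ x ^ (-s - 1) := Real.rpow_nonneg hx0.le _
    rw [Real.norm_of_nonneg (mul_nonneg h3 hq)]
    refine mul_le_of_le_one_left hq ?_
    have := Real.exp_pos (-x)
    linarith

lemma integral_one_sub_exp_mul_rpow {s : ℝ} (h0 : 0 < s) (h1 : s < 1) :
    ∫ x in Set.Ioi (0 : ℝ), (1 - Real.exp (-x)) * x ^ (-s - 1) = Real.Gamma (1 - s) / s := by
  have hI := integrableOn_one_sub_exp_mul_rpow h0 h1
  have hG := Real.GammaIntegral_convergent (s := 1 - s) (by linarith)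
  have hGe : (fun x : ℝ => Real.exp (-x) * x ^ (1 - s - 1))
      = fun x => Real.exp (-x) * x ^ (-s) := by
    funext x; ring_nf
  rw [hGe] at hG
  set F : ℝ → ℝ := fun x => (1 - Real.exp (-x)) * x ^ (-s) with hF
  have hFb : ∀ x : ℝ, 0 ≤ x → |F x| ≤ x ^ (1 - s) := by
    intro x hx
    rcases hx.eq_or_lt with rfl | hx
    · simp [hF, Real.zero_rpow (by linarith : 1 - s ≠ 0)]
    have h3 := one_sub_exp_neg_nonneg hx.le
    have hq : 0 ≤ x ^ (-s) := Real.rpow_nonneg hx.le _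
    rw [abs_of_nonneg (mul_nonneg h3 hq)]
    calc _ ≤ x * x ^ (-s) := by gcongr; exact one_sub_exp_neg_le x
      _ = x ^ (1 - s) := by rw [mul_comm, ← Real.rpow_add_one hx.ne']; ring_nf
  have hFb' : ∀ x : ℝ, 0 ≤ x → |F x| ≤ x ^ (-s) := by
    intro x hx
    have h3 := one_sub_exp_neg_nonneg hx
    have hq : 0 ≤ x ^ (-s) := Real.rpow_nonneg hx _
    rw [abs_of_nonneg (mul_nonneg h3 hq)]
    refine mul_le_of_le_one_left hq ?_
    have := Real.exp_pos (-x)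
    linarith
  have hF0 : F 0 = 0 := by simp [hF]
  have hcont : ContinuousWithinAt F (Set.Ici 0) 0 := by
    rw [ContinuousWithinAt, hF0]
    refine squeeze_zero_norm' (a := fun x => x ^ (1 - s)) ?_ ?_
    · filter_upwards [self_mem_nhdsWithin] with x hx using hFb x hx
    · have := (Real.continuousAt_rpow_const 0 (1 - s) (Or.inr (by linarith))).tendsto
      rw [Real.zero_rpow (by linarith)] at this
      exact this.mono_left nhdsWithin_le_nhds
  have hlim : Filter.Tendsto F Filter.atTop (nhds 0) := by
    refine squeeze_zero_norm' (a := fun x => x ^ (-s)) ?_ (tendsto_rpow_neg_atTop h0)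
    filter_upwards [Filter.eventually_ge_atTop 0] with x hx using hFb' x hx
  have h := integral_Ioi_of_hasDerivAt_of_tendsto (f := F)
    (f' := fun x => Real.exp (-x) * x ^ (-s) - s * ((1 - Real.exp (-x)) * x ^ (-s - 1)))
    hcont (fun x hx => by
      have h := ((hasDerivAt_exp_neg x).const_sub 1).mul
        (Real.hasDerivAt_rpow_const (p := -s) (Or.inl (ne_of_gt hx)))
      convert! h using 1
      ring) (hG.sub (hI.const_mul s)) hlim
  rw [integral_sub hG (hI.const_mul s), integral_const_mul, hF0] at h
  have hGamma : Real.Gamma (1 - s) = ∫ x in Set.Ioi (0 : ℝ), Real.exp (-x) * x ^ (-s) := by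
    rw [Real.Gamma_eq_integral (by linarith), hGe]
  rw [hGamma]
  field_simp
  linarith

lemma map_abs_volume :
    Measure.map (fun x : ℝ => |x|) volume = (2 : ENNReal) • volume.restrict (Set.Ici 0) := by
  ext s hs
  rw [Measure.map_apply (by fun_prop) hs, Measure.smul_apply, Measure.restrict_apply hs,
    smul_eq_mul, ← measure_inter_add_sdiff₀ _ (measurableSet_Ici (a := (0 : ℝ))).nullMeasurableSet]
  have h1 : (fun x : ℝ => |x|) ⁻¹' s ∩ Set.Ici 0 = s ∩ Set.Ici 0 := by
    ext x
    simp only [Set.mem_inter_iff, Set.mem_preimage, Set.mem_Ici, and_congr_left_iff]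
    intro hx
    rw [abs_of_nonneg hx]
  have h2 : (fun x : ℝ => |x|) ⁻¹' s \ Set.Ici 0 = (fun x : ℝ => -x) ⁻¹' (s ∩ Set.Ioi 0) := by
    ext x
    simp only [Set.mem_sdiff, Set.mem_preimage, Set.mem_Ici, not_le, Set.mem_inter_iff,
      Set.mem_Ioi, Left.neg_pos_iff, and_congr_left_iff]
    intro hx
    rw [abs_of_neg hx]
  have h3 : volume (s ∩ Set.Ioi 0) = volume (s ∩ Set.Ici 0) :=
    measure_congr ((Filter.EventuallyEq.refl _ _).inter Ioi_ae_eq_Ici)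
  rw [h1, h2, Measure.measure_preimage_neg, h3, two_mul]

lemma map_pi_abs_volume (ι : Type*) [Fintype ι] :
    Measure.map (fun (x : ι → ℝ) i => |x i|) volume
      = (2 : ENNReal) ^ Fintype.card ι • volume.restrict (Set.univ.pi fun _ => Set.Ici 0) := by
  have hs : SigmaFinite (Measure.map (fun x : ℝ => |x|) volume) := by
    rw [map_abs_volume, two_smul]; infer_instance
  rw [volume_pi, Measure.pi_map_pi (f := fun _ x => |x|) (fun _ => by fun_prop),
    Measure.restrict_pi_pi]
  refine Measure.pi_eq fun s hs => ?_
  simp only [map_abs_volume, Measure.smul_apply, Measure.pi_pi, smul_eq_mul,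
    Finset.prod_mul_distrib, Finset.prod_const, Finset.card_univ]

lemma integral_comp_pi_abs {ι : Type*} [Fintype ι] {F : (ι → ℝ) → ℝ} (hF : Measurable F) :
    ∫ x : ι → ℝ, F (fun i => |x i|)
      = 2 ^ Fintype.card ι * ∫ x in Set.univ.pi fun _ : ι => Set.Ici 0, F x := by
  rw [← integral_map (φ := fun (x : ι → ℝ) i => |x i|)
    (show Measurable _ by fun_prop).aemeasurable hF.aestronglyMeasurable,
    map_pi_abs_volume, integral_smul_measure]
  simp

section Radial

variable {d : ℕ} {s b : ℝ}

lemma expQuot_radial_eq (hd : 1 ≤ d) (hb : 0 < b) {y : ℝ} (hy : 0 < y) :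
    y ^ (d - 1) • expQuot ((d : ℝ) / 2 + s) (b * y ^ 2)
      = (b ^ (1 - (d : ℝ) / 2) / 2) * ((|(2 : ℝ)| * y ^ ((2 : ℝ) - 1)) •
        (fun u => (fun x => (1 - Real.exp (-x)) * x ^ (-s - 1)) (b * u)) (y ^ (2 : ℝ))) := by
  have h2 : y ^ (2 : ℝ) = y ^ 2 := by norm_cast
  have hby : 0 < b * y ^ 2 := by positivity
  have hyn : y ^ (d - 1) = y ^ ((d : ℝ) - 1) := by
    rw [← Real.rpow_natCast, Nat.cast_sub hd, Nat.cast_one]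
  have hexp : ∀ r : ℝ, (b * y ^ 2) ^ r = b ^ r * y ^ (2 * r) := by
    intro r
    rw [Real.mul_rpow hb.le (by positivity), ← h2, ← Real.rpow_mul hy.le]
  simp only [smul_eq_mul, h2]
  rw [expQuot_eq_mul _ hby.le, hexp, hexp, hyn, abs_of_pos two_pos]
  have e1 : y ^ ((d : ℝ) - 1) * y ^ (2 * -((d : ℝ) / 2 + s))
      = y ^ ((2 : ℝ) - 1) * y ^ (2 * (-s - 1)) := by
    rw [← Real.rpow_add hy, ← Real.rpow_add hy]; ring_nf
  have e2 : b ^ (-((d : ℝ) / 2 + s)) = b ^ (1 - (d : ℝ) / 2) * b ^ (-s - 1) := by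
    rw [← Real.rpow_add hb]; ring_nf
  rw [e2]
  linear_combination (1 - Real.exp (-(b * y ^ 2))) * b ^ (1 - (d : ℝ) / 2) * b ^ (-s - 1) * e1

lemma integrableOn_radial_expQuot (hd : 1 ≤ d) (h0 : 0 < s) (h1 : s < 1) (hb : 0 < b) :
    IntegrableOn (fun y : ℝ => y ^ (d - 1) • expQuot ((d : ℝ) / 2 + s) (b * y ^ 2))
      (Set.Ioi 0) := by
  refine IntegrableOn.congr_fun ?_ (fun y hy => (expQuot_radial_eq hd hb hy).symm)
    measurableSet_Ioi
  refine Integrable.const_mul ?_ _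
  refine (integrableOn_Ioi_comp_rpow_iff (fun u =>
    (fun x => (1 - Real.exp (-x)) * x ^ (-s - 1)) (b * u)) two_ne_zero).2 ?_
  rw [integrableOn_Ioi_comp_mul_left_iff (fun x => (1 - Real.exp (-x)) * x ^ (-s - 1)) 0 hb,
    mul_zero]
  exact integrableOn_one_sub_exp_mul_rpow h0 h1

lemma integral_radial_expQuot (hd : 1 ≤ d) (h0 : 0 < s) (h1 : s < 1) (hb : 0 < b) :
    ∫ y in Set.Ioi (0 : ℝ), y ^ (d - 1) • expQuot ((d : ℝ) / 2 + s) (b * y ^ 2)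
      = b ^ (-((d : ℝ) / 2)) / 2 * (Real.Gamma (1 - s) / s) := by
  rw [setIntegral_congr_fun measurableSet_Ioi (fun y hy => expQuot_radial_eq hd hb hy),
    integral_const_mul, integral_comp_rpow_Ioi (fun u =>
    (fun x => (1 - Real.exp (-x)) * x ^ (-s - 1)) (b * u)) two_ne_zero,
    integral_comp_mul_left_Ioi (fun x => (1 - Real.exp (-x)) * x ^ (-s - 1)) 0 hb, mul_zero, integral_one_sub_exp_mul_rpow h0 h1, smul_eq_mul,
    sub_eq_add_neg 1 ((d : ℝ) / 2), Real.rpow_add hb, Real.rpow_one]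
  field_simp

lemma measurable_expQuot_sum_sq (p : ℝ) :
    Measurable (fun x : Fin d → ℝ => expQuot p (b * ∑ i, x i ^ 2)) :=
  (measurable_expQuot p).comp (by fun_prop)

lemma expQuot_norm_eq (p : ℝ) (x : EuclideanSpace ℝ (Fin d)) :
    expQuot p (b * ∑ i, x i ^ 2) = (fun r => expQuot p (b * r ^ 2)) ‖x‖ := by
  simp only [EuclideanSpace.real_norm_sq_eq]

lemma integrable_expQuot_sum_sq (hd : 1 ≤ d) (h0 : 0 < s) (h1 : s < 1) (hb : 0 < b) :
    Integrable (fun x : Fin d → ℝ => expQuot ((d : ℝ) / 2 + s) (b * ∑ i, x i ^ 2)) := by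
  have : Nonempty (Fin d) := ⟨⟨0, hd⟩⟩
  rw [← (PiLp.volume_preserving_ofLp (Fin d)).integrable_comp
    (measurable_expQuot_sum_sq _).aestronglyMeasurable]
  have h := (integrable_fun_norm_addHaar (E := EuclideanSpace ℝ (Fin d)) volume
    (f := fun r => expQuot ((d : ℝ) / 2 + s) (b * r ^ 2))).2 (by
      rw [finrank_euclideanSpace_fin]
      exact integrableOn_radial_expQuot hd h0 h1 hb)
  exact h.congr (Filter.Eventually.of_forall fun x => (expQuot_norm_eq _ x).symm)

lemma integral_expQuot_sum_sq (hd : 1 ≤ d) (h0 : 0 < s) (h1 : s < 1) (hb : 0 < b) :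
    ∫ x : Fin d → ℝ, expQuot ((d : ℝ) / 2 + s) (b * ∑ i, x i ^ 2)
      = Real.pi ^ ((d : ℝ) / 2) / Real.Gamma ((d : ℝ) / 2) * b ^ (-((d : ℝ) / 2))
        * (Real.Gamma (1 - s) / s) := by
  have : Nonempty (Fin d) := ⟨⟨0, hd⟩⟩
  have hd0 : (d : ℝ) ≠ 0 := by positivity
  have hG : 0 < Real.Gamma ((d : ℝ) / 2) := Real.Gamma_pos_of_pos (by positivity)
  rw [← (PiLp.volume_preserving_ofLp (Fin d)).integral_comp
    (MeasurableEquiv.toLp 2 (Fin d → ℝ)).symm.measurableEmbedding]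
  simp only [expQuot_norm_eq]
  rw [integral_fun_norm_addHaar (E := EuclideanSpace ℝ (Fin d)) volume
    (fun r => expQuot ((d : ℝ) / 2 + s) (b * r ^ 2)), finrank_euclideanSpace_fin, integral_radial_expQuot hd h0 h1 hb,
    measureReal_def, EuclideanSpace.volume_ball, Fintype.card_fin, ENNReal.ofReal_one, one_pow,
    one_mul, ENNReal.toReal_ofReal (by positivity), Real.Gamma_add_one (by positivity),
    Real.sqrt_eq_rpow, ← Real.rpow_natCast, ← Real.rpow_mul Real.pi_pos.le]
  simp only [smul_eq_mul, nsmul_eq_mul]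
  rw [show (1 / 2 : ℝ) * d = d / 2 by ring]
  field_simp

lemma setIntegral_orthant_expQuot_sum_sq {η : ℝ} (hd : 1 ≤ d) (h0 : 0 < s) (h1 : s < 1)
    (hη : 0 < η) :
    ∫ x in Set.univ.pi fun _ : Fin d => Set.Ici (0 : ℝ),
        expQuot ((d : ℝ) / 2 + s) (Real.pi ^ 2 * η * ∑ i, x i ^ 2)
      = Real.Gamma (1 - s) /
        (2 ^ d * (Real.pi * η) ^ ((d : ℝ) / 2) * s * Real.Gamma ((d : ℝ) / 2)) := by
  have hG : 0 < Real.Gamma ((d : ℝ) / 2) := Real.Gamma_pos_of_pos (by positivity)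
  have hπ := Real.pi_pos
  have h := integral_comp_pi_abs (measurable_expQuot_sum_sq (d := d)
    (b := Real.pi ^ 2 * η) ((d : ℝ) / 2 + s))
  simp only [sq_abs, Fintype.card_fin] at h
  rw [integral_expQuot_sum_sq hd h0 h1 (by positivity)] at h
  have hp : (Real.pi ^ 2 * η) ^ (-((d : ℝ) / 2)) * Real.pi ^ ((d : ℝ) / 2)
      = ((Real.pi * η) ^ ((d : ℝ) / 2))⁻¹ := by
    rw [← Real.rpow_neg (by positivity), show Real.pi ^ 2 * η = Real.pi * (Real.pi * η) by ring,
      Real.mul_rpow hπ.le (by positivity), Real.rpow_neg hπ.le]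
    field_simp
  have hX : 0 < (Real.pi * η) ^ ((d : ℝ) / 2) := by positivity
  rw [eq_comm, mul_comm, ← eq_div_iff (by positivity)] at h
  rw [h]
  calc _ = ((Real.pi ^ 2 * η) ^ (-((d : ℝ) / 2)) * Real.pi ^ ((d : ℝ) / 2))
        * (Real.Gamma (1 - s) / s) / Real.Gamma ((d : ℝ) / 2) / 2 ^ d := by ring
    _ = _ := by
      rw [hp]
      field_simp

end Radial

/-- The half-open unit cube centred at `k`. -/
def unitCell {d : ℕ} (k : Fin d → ℝ) : Set (Fin d → ℝ) :=
  Set.univ.pi fun i => Set.Ico (k i - 1 / 2) (k i + 1 / 2)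

section Cell

variable {d : ℕ} {k : Fin d → ℝ} {p b : ℝ}

lemma measurableSet_unitCell (k : Fin d → ℝ) : MeasurableSet (unitCell k) :=
  MeasurableSet.univ_pi fun _ => measurableSet_Ico

lemma isProbabilityMeasure_restrict_Ico (x : ℝ) :
    IsProbabilityMeasure ((volume : Measure ℝ).restrict (Set.Ico (x - 1 / 2) (x + 1 / 2))) := by
  constructor
  rw [Measure.restrict_apply_univ, Real.volume_Ico]
  norm_num

lemma restrict_unitCell (k : Fin d → ℝ) : (volume : Measure (Fin d → ℝ)).restrict (unitCell k)
    = Measure.pi fun i => volume.restrict (Set.Ico (k i - 1 / 2) (k i + 1 / 2)) := by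
  rw [unitCell, volume_pi, Measure.restrict_pi_pi]

lemma volume_unitCell (k : Fin d → ℝ) : volume (unitCell k) = 1 := by
  rw [unitCell, volume_pi_pi]
  simp only [Real.volume_Ico]
  norm_num

lemma integrableOn_unitCell_eval_sub (k : Fin d → ℝ) (i : Fin d) :
    IntegrableOn (fun y : Fin d → ℝ => y i - k i) (unitCell k) := by
  have := fun i => isProbabilityMeasure_restrict_Ico (k i)
  rw [IntegrableOn, restrict_unitCell]
  refine integrable_comp_eval (X := fun _ => ℝ) (f := fun t => t - k i) ?_
  exact ((continuous_id.sub continuous_const).continuousOn.integrableOn_Icc).mono_set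
    Set.Ico_subset_Icc_self

lemma setIntegral_unitCell_eval_sub (k : Fin d → ℝ) (i : Fin d) :
    ∫ y in unitCell k, (y i - k i) = 0 := by
  have := fun i => isProbabilityMeasure_restrict_Ico (k i)
  rw [restrict_unitCell, integral_comp_eval (X := fun _ => ℝ) (f := fun t => t - k i) (by fun_prop),
    integral_Ico_eq_integral_Ioc, ← intervalIntegral.integral_of_le (by linarith),
    intervalIntegral.integral_sub (by simp) (by simp), integral_id,
    intervalIntegral.integral_const, smul_eq_mul]
  ring

/-- The midpoint rule on a unit cube is exact on affine functions. -/
lemma abs_setIntegral_unitCell_sub_le {F : (Fin d → ℝ) → ℝ} (hF : IntegrableOn F (unitCell k))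
    (A E : ℝ) (c : Fin d → ℝ)
    (h : ∀ y ∈ unitCell k, |F y - A - ∑ i, c i * (y i - k i)| ≤ E) :
    |(∫ y in unitCell k, F y) - A| ≤ E := by
  have hA : IntegrableOn (fun _ : Fin d → ℝ => A) (unitCell k) :=
    integrableOn_const (by rw [volume_unitCell]; exact ENNReal.one_ne_top)
  have hL : ∀ i ∈ Finset.univ, IntegrableOn (fun y : Fin d → ℝ => c i * (y i - k i)) (unitCell k) :=
    fun i _ => (integrableOn_unitCell_eval_sub k i).const_mul _
  have hv : volume.real (unitCell k) = 1 := by simp [measureReal_def, volume_unitCell]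
  have hF_int := norm_setIntegral_le_of_norm_le_const
    (f := fun y => F y - A - ∑ i, c i * (y i - k i))
    (by rw [volume_unitCell]; exact ENNReal.one_lt_top : volume (unitCell k) < ⊤) h
  rw [hv, mul_one, integral_sub (f := fun y => F y - A) (hF.sub hA) (integrable_finsetSum _ hL), integral_sub hF hA,
    integral_finsetSum _ hL, setIntegral_const, hv, one_smul] at hF_int
  simpa [integral_const_mul, setIntegral_unitCell_eval_sub] using hF_int

lemma abs_sub_le_of_mem_unitCell {y : Fin d → ℝ} (hy : y ∈ unitCell k) (i : Fin d) :
    |y i - k i| ≤ 1 / 2 := by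
  have := hy i trivial
  rw [abs_le]
  constructor <;> linarith [this.1, this.2]

lemma one_le_sum_sq (hd : 1 ≤ d) (hk : ∀ i, 1 ≤ k i) : 1 ≤ ∑ i, k i ^ 2 :=
  (one_le_pow₀ (hk ⟨0, hd⟩)).trans
    (Finset.single_le_sum (f := fun i => k i ^ 2) (fun _ _ => sq_nonneg _) (Finset.mem_univ _))

lemma sum_sq_div_four_le_of_mem_unitCell (hk : ∀ i, 1 ≤ k i) {y : Fin d → ℝ}
    (hy : y ∈ unitCell k) : (∑ i, k i ^ 2) / 4 ≤ ∑ i, y i ^ 2 := by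
  rw [Finset.sum_div]
  refine Finset.sum_le_sum fun i _ => ?_
  have := abs_le.1 (abs_sub_le_of_mem_unitCell hy i)
  nlinarith [hk i, this.1]

lemma sum_sq_le_of_mem_unitCell (hk : ∀ i, 1 ≤ k i) {y : Fin d → ℝ}
    (hy : y ∈ unitCell k) : ∑ i, y i ^ 2 ≤ 4 * ∑ i, k i ^ 2 := by
  rw [Finset.mul_sum]
  refine Finset.sum_le_sum fun i _ => ?_
  have := abs_le.1 (abs_sub_le_of_mem_unitCell hy i)
  nlinarith [hk i, this.1, this.2]

lemma sq_sum_sq_sub_le_of_mem_unitCell (hk : ∀ i, 1 ≤ k i) {y : Fin d → ℝ}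
    (hy : y ∈ unitCell k) :
    (∑ i, y i ^ 2 - ∑ i, k i ^ 2) ^ 2 ≤ 4 * d * ∑ i, k i ^ 2 := by
  rw [← Finset.sum_sub_distrib]
  refine sq_sum_le_card_mul_sum_sq.trans ?_
  rw [Finset.card_univ, Fintype.card_fin, mul_comm (4 : ℝ), mul_assoc, Finset.mul_sum
    Finset.univ _ (4 : ℝ)]
  gcongr with i
  have h := abs_le.1 (abs_sub_le_of_mem_unitCell hy i)
  have h1 := hk i
  rw [← sq_abs, show 4 * k i ^ 2 = (2 * k i) ^ 2 by ring]
  refine pow_le_pow_left₀ (abs_nonneg _) ?_ 2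
  rw [abs_le]
  constructor <;> nlinarith [h.1, h.2]

lemma sum_sub_sq_le_of_mem_unitCell {y : Fin d → ℝ} (hy : y ∈ unitCell k) :
    ∑ i, (y i - k i) ^ 2 ≤ d := by
  calc _ ≤ ∑ _i : Fin d, (1 : ℝ) := by
        refine Finset.sum_le_sum fun i _ => ?_
        have := abs_le.1 (abs_sub_le_of_mem_unitCell hy i)
        nlinarith [this.1, this.2]
    _ = d := by simp

lemma abs_setIntegral_unitCell_expQuot_sub_le (hd : 1 ≤ d) (hp : 0 < p) (hb : 0 < b)
    (hk : ∀ i, 1 ≤ k i)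
    (hF_int : IntegrableOn (fun y : Fin d → ℝ => expQuot p (b * ∑ i, y i ^ 2)) (unitCell k)) :
    |(∫ y in unitCell k, expQuot p (b * ∑ i, y i ^ 2)) - expQuot p (b * ∑ i, k i ^ 2)|
      ≤ ((1 + 2 * p + p * (p + 1)) * 4 ^ (p + 1) * (4 * d) + (1 + p) * d)
        * (b ^ (1 - p) * (∑ i, k i ^ 2) ^ (-p)) := by
  set N := ∑ i, k i ^ 2 with hN
  have hN0 : 0 < N := one_pos.trans_le (one_le_sum_sq hd hk)
  refine abs_setIntegral_unitCell_sub_le hF_int _ _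
    (fun i => expQuotDeriv p (b * N) * b * (2 * k i)) fun y hy => ?_
  set Y := ∑ i, y i ^ 2 with hY
  set W := ∑ i, (y i - k i) ^ 2 with hW
  have hsplit : ∑ i, expQuotDeriv p (b * N) * b * (2 * k i) * (y i - k i)
      = expQuotDeriv p (b * N) * b * (Y - N - W) := by
    have hexp : Y - N - W = ∑ i, 2 * k i * (y i - k i) := by
      rw [hY, hN, hW, ← Finset.sum_sub_distrib, ← Finset.sum_sub_distrib]
      exact Finset.sum_congr rfl fun i _ => by ring
    rw [hexp, Finset.mul_sum _ _ (expQuotDeriv p (b * N) * b)]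
    exact Finset.sum_congr rfl fun i _ => by ring
  have hW0 : 0 ≤ W := Finset.sum_nonneg fun i _ => sq_nonneg _
  have hW1 : W ≤ d := sum_sub_sq_le_of_mem_unitCell hy
  have hYN : N / 4 ≤ Y := sum_sq_div_four_le_of_mem_unitCell hk hy
  have hsq : (Y - N) ^ 2 ≤ 4 * d * N := sq_sum_sq_sub_le_of_mem_unitCell hk hy
  have hT := abs_expQuot_sub_sub_le hp (b := b * N / 4) (x := b * N) (y := b * Y)
    (by positivity) (by nlinarith [mul_pos hb hN0]) (by nlinarith)
  have hD := abs_expQuotDeriv_le hp (x := b * N) (by positivity)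
  have e1 : (b * N / 4) ^ (-p - 1) * (b ^ 2 * N) = 4 ^ (p + 1) * (b ^ (1 - p) * N ^ (-p)) := by
    have h4 : (4 : ℝ) ^ (-p - 1) = (4 ^ (p + 1))⁻¹ := by
      rw [← Real.rpow_neg (by norm_num)]; ring_nf
    have hbb : b ^ (1 - p) = b ^ (-p - 1) * b ^ 2 := by
      rw [← Real.rpow_natCast b 2, ← Real.rpow_add hb]; congr 1; push_cast; ring
    have hNN : N ^ (-p) = N ^ (-p - 1) * N := by
      rw [← Real.rpow_add_one hN0.ne']; ring_nf
    rw [Real.div_rpow (by positivity) (by norm_num), Real.mul_rpow hb.le hN0.le, h4, hbb, hNN,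
      div_inv_eq_mul]
    ring
  have e2 : (b * N) ^ (-p) * b = b ^ (1 - p) * N ^ (-p) := by
    have hbb : b ^ (1 - p) = b ^ (-p) * b := by
      rw [← Real.rpow_add_one hb.ne']; ring_nf
    rw [Real.mul_rpow hb.le hN0.le, hbb]
    ring
  have hX : 0 ≤ (b * N / 4) ^ (-p - 1) := by positivity
  rw [hsplit]
  calc _ = |(expQuot p (b * Y) - expQuot p (b * N) - expQuotDeriv p (b * N) * (b * Y - b * N))
        + expQuotDeriv p (b * N) * (b * W)| := by congr 1; ring
    _ ≤ (1 + 2 * p + p * (p + 1)) * (b * N / 4) ^ (-p - 1) * (b * Y - b * N) ^ 2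
        + (1 + p) * (b * N) ^ (-p) * (b * d) := by
      refine (abs_add_le _ _).trans (add_le_add hT ?_)
      rw [abs_mul, abs_of_nonneg (by positivity : 0 ≤ b * W)]
      gcongr
    _ = (1 + 2 * p + p * (p + 1)) * ((b * N / 4) ^ (-p - 1) * b ^ 2 * (Y - N) ^ 2)
        + (1 + p) * ((b * N) ^ (-p) * b) * d := by ring
    _ ≤ (1 + 2 * p + p * (p + 1)) * ((b * N / 4) ^ (-p - 1) * b ^ 2 * (4 * d * N))
        + (1 + p) * ((b * N) ^ (-p) * b) * d := by gcongr
    _ = (1 + 2 * p + p * (p + 1)) * ((b * N / 4) ^ (-p - 1) * (b ^ 2 * N)) * (4 * d)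
        + (1 + p) * ((b * N) ^ (-p) * b) * d := by ring
    _ = _ := by rw [e1, e2]; ring

lemma rpow_neg_sum_sq_le (hd : 1 ≤ d) (hp : 0 < p) (hk : ∀ i, 1 ≤ k i)
    (hF_int : IntegrableOn (fun y : Fin d → ℝ => expQuot p (1 * ∑ i, y i ^ 2)) (unitCell k)) :
    (1 - Real.exp (-(1 / 4))) * 4 ^ (-p) * (∑ i, k i ^ 2) ^ (-p)
      ≤ ∫ y in unitCell k, expQuot p (1 * ∑ i, y i ^ 2) := by
  set N := ∑ i, k i ^ 2 with hN
  have hN1 : 1 ≤ N := one_le_sum_sq hd hk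
  have hv : volume.real (unitCell k) = 1 := by simp [measureReal_def, volume_unitCell]
  have h := setIntegral_mono_on (μ := volume) (s := unitCell k)
    (f := fun _ => (1 - Real.exp (-(1 / 4))) * 4 ^ (-p) * N ^ (-p))
    (integrableOn_const (by rw [volume_unitCell]; exact ENNReal.one_ne_top)) hF_int
    (measurableSet_unitCell k) (fun y hy => by
      have h1 := sum_sq_div_four_le_of_mem_unitCell hk hy
      have h2 := sum_sq_le_of_mem_unitCell hk hy
      rw [← hN] at h1 h2
      have hY : 0 < ∑ i, y i ^ 2 := by linarith
      rw [one_mul, expQuot_eq_mul p hY.le, mul_assoc, ← Real.mul_rpow (by norm_num) (by linarith)]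
      refine mul_le_mul ?_ (Real.rpow_le_rpow_of_nonpos hY h2 (by linarith)) (by positivity)
        (one_sub_exp_neg_nonneg hY.le)
      have : Real.exp (-∑ i, y i ^ 2) ≤ Real.exp (-(1 / 4)) := Real.exp_le_exp.2 (by linarith)
      linarith)
  rwa [setIntegral_const, hv, one_smul] at h

lemma pairwise_disjoint_unitCell : Pairwise (Function.onFun Disjoint
    fun k : Fin d → ℕ+ => unitCell fun i => ((k i : ℕ) : ℝ)) := by
  intro k l hkl
  rw [Function.onFun, Set.disjoint_left]
  intro y hk hl
  refine hkl (funext fun i => PNat.coe_injective ?_)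
  have h1 := hk i trivial
  have h2 := hl i trivial
  have h3 : ((k i : ℕ) : ℝ) < ((l i : ℕ) : ℝ) + 1 := by linarith [h1.1, h2.2]
  have h4 : ((l i : ℕ) : ℝ) < ((k i : ℕ) : ℝ) + 1 := by linarith [h2.1, h1.2]
  have h5 : (k i : ℕ) < l i + 1 := by exact_mod_cast h3
  have h6 : (l i : ℕ) < k i + 1 := by exact_mod_cast h4
  exact le_antisymm (Nat.lt_succ_iff.1 h5) (Nat.lt_succ_iff.1 h6)

lemma iUnion_unitCell : ⋃ k : Fin d → ℕ+, unitCell (fun i => ((k i : ℕ) : ℝ))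
    = Set.univ.pi fun _ => Set.Ici (1 / 2) := by
  ext y
  simp only [Set.mem_iUnion, unitCell, Set.mem_pi, Set.mem_univ, true_imp_iff, Set.mem_Ici,
    Set.mem_Ico]
  constructor
  · rintro ⟨k, hk⟩ i
    have h1 : (1 : ℝ) ≤ (k i : ℕ) := by exact_mod_cast (k i).pos
    linarith [(hk i).1]
  · intro hy
    have hpos : ∀ i, 0 < ⌊y i + 1 / 2⌋₊ := fun i => Nat.floor_pos.2 (by linarith [hy i])
    refine ⟨fun i => ⟨⌊y i + 1 / 2⌋₊, hpos i⟩, fun i => ?_⟩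
    have h1 := Nat.floor_le (by linarith [hy i] : 0 ≤ y i + 1 / 2)
    have h2 := Nat.lt_floor_add_one (y i + 1 / 2)
    simp only [PNat.mk_coe]
    constructor <;> linarith

end Cell

section RiemannSum

variable {d : ℕ} {s : ℝ}

lemma one_le_pnat_cast (k : Fin d → ℕ+) (i : Fin d) : (1 : ℝ) ≤ ((k i : ℕ) : ℝ) := by
  exact_mod_cast (k i).pos

lemma hasSum_setIntegral_unitCell (hd : 1 ≤ d) (h0 : 0 < s) (h1 : s < 1) {b : ℝ} (hb : 0 < b) :
    HasSum (fun k : Fin d → ℕ+ => ∫ y in unitCell (fun i => ((k i : ℕ) : ℝ)),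
        expQuot ((d : ℝ) / 2 + s) (b * ∑ i, y i ^ 2))
      (∫ y in Set.univ.pi fun _ : Fin d => Set.Ici (1 / 2),
        expQuot ((d : ℝ) / 2 + s) (b * ∑ i, y i ^ 2)) := by
  rw [← iUnion_unitCell]
  exact hasSum_integral_iUnion (fun _ => measurableSet_unitCell _) pairwise_disjoint_unitCell
    (integrable_expQuot_sum_sq hd h0 h1 hb).integrableOn

lemma summable_rpow_neg_sum_sq (hd : 1 ≤ d) (h0 : 0 < s) (h1 : s < 1) :
    Summable (fun k : Fin d → ℕ+ => (∑ i, ((k i : ℕ) : ℝ) ^ 2) ^ (-((d : ℝ) / 2 + s))) := by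
  have hp : 0 < (d : ℝ) / 2 + s := by positivity
  have hc : 0 < (1 - Real.exp (-(1 / 4))) * (4 : ℝ) ^ (-((d : ℝ) / 2 + s)) := by
    have : Real.exp (-(1 / 4)) < 1 := Real.exp_lt_one_iff.2 (by norm_num)
    have h2 : 0 < 1 - Real.exp (-(1 / 4)) := by linarith
    positivity
  rw [← summable_mul_left_iff hc.ne']
  exact (hasSum_setIntegral_unitCell hd h0 h1 one_pos).summable.of_nonneg_of_le
    (fun k => by positivity)
    fun k => rpow_neg_sum_sq_le hd hp (one_le_pnat_cast k)
      (integrable_expQuot_sum_sq hd h0 h1 one_pos).integrableOn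

lemma abs_expQuot_shift_sub_setIntegral_le (hd : 1 ≤ d) (h0 : 0 < s) (h1 : s < 1) {a c : ℝ}
    (ha : 0 < a) (hc : 0 < c + a * d) :
    ∃ C > 0, ∀ Δ > 0, ∀ k : Fin d → ℕ+,
      |expQuot ((d : ℝ) / 2 + s) ((c + a * ∑ i, ((k i : ℕ) : ℝ) ^ 2) * Δ)
        - ∫ y in unitCell (fun i => ((k i : ℕ) : ℝ)),
          expQuot ((d : ℝ) / 2 + s) (a * Δ * ∑ i, y i ^ 2)|
        ≤ C * Δ ^ (1 - ((d : ℝ) / 2 + s)) *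
          (∑ i, ((k i : ℕ) : ℝ) ^ 2) ^ (-((d : ℝ) / 2 + s)) := by
  have hd0 : (0 : ℝ) < d := by exact_mod_cast hd
  set p := (d : ℝ) / 2 + s with hpdef
  have hp : 0 < p := by positivity
  set δ := min a (a + c / d) with hδ
  have hδ0 : 0 < δ := by
    refine lt_min ha ?_
    have : a + c / d = (c + a * d) / d := by field_simp; ring
    rw [this]
    positivity
  set C₁ := (1 + 2 * p + p * (p + 1)) * 4 ^ (p + 1) * (4 * d) + (1 + p) * d with hC₁
  have hC₁0 : 0 < C₁ := by positivity
  refine ⟨C₁ * a ^ (1 - p) + (1 + p) * |c| * δ ^ (-p), by positivity, fun Δ hΔ k => ?_⟩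
  have hk := one_le_pnat_cast k
  set N := ∑ i, ((k i : ℕ) : ℝ) ^ 2 with hN
  have hNd : (d : ℝ) ≤ N := by
    calc (d : ℝ) = ∑ _i : Fin d, (1 : ℝ) := by simp
      _ ≤ N := Finset.sum_le_sum fun i _ => one_le_pow₀ (hk i)
  have hN0 : 0 < N := hd0.trans_le hNd
  have hδa : δ * N ≤ a * N := by gcongr; exact min_le_left _ _
  have hδc : δ * N ≤ c + a * N := by
    rcases le_total 0 c with h | h
    · linarith
    · calc δ * N ≤ (a + c / d) * N := by gcongr; exact min_le_right _ _
        _ = a * N + c * (N / d) := by ring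
        _ ≤ a * N + c * 1 := by
          have : 1 ≤ N / d := (one_le_div hd0).2 hNd
          linarith [mul_le_mul_of_nonpos_left this h]
        _ = c + a * N := by ring
  have hcell := abs_setIntegral_unitCell_expQuot_sub_le hd hp (mul_pos ha hΔ) hk
    (integrable_expQuot_sum_sq hd h0 h1 (mul_pos ha hΔ)).integrableOn
  have hshift := abs_expQuot_sub_le hp (b := δ * N * Δ) (x := a * Δ * N) (y := (c + a * N) * Δ)
    (by positivity) (by nlinarith) (by gcongr)
  have e1 : (a * Δ) ^ (1 - p) = a ^ (1 - p) * Δ ^ (1 - p) := Real.mul_rpow ha.le hΔ.le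
  have e2 : (δ * N * Δ) ^ (-p) * |(c + a * N) * Δ - a * Δ * N|
      = |c| * δ ^ (-p) * (Δ ^ (1 - p) * N ^ (-p)) := by
    have hΔΔ : Δ ^ (1 - p) = Δ ^ (-p) * Δ := by
      rw [← Real.rpow_add_one hΔ.ne']; ring_nf
    rw [show (c + a * N) * Δ - a * Δ * N = c * Δ by ring, abs_mul, abs_of_pos hΔ,
      Real.mul_rpow (by positivity) hΔ.le, Real.mul_rpow hδ0.le hN0.le, hΔΔ]
    ring
  rw [abs_sub_comm] at hcell
  rw [← hN, e1] at hcell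
  refine (abs_sub_le _ (expQuot p (a * Δ * N)) _).trans ((add_le_add hshift hcell).trans_eq ?_)
  rw [mul_assoc (1 + p), e2]
  ring

/-- The midpoint Riemann sum, with shifted argument, approximates the integral over the shifted
orthant to second order. -/
lemma abs_tsum_expQuot_sub_setIntegral_le (hd : 1 ≤ d) (h0 : 0 < s) (h1 : s < 1) {a c : ℝ}
    (ha : 0 < a) (hc : 0 < c + a * d) :
    ∃ C > 0, ∀ Δ > 0,
      Summable (fun k : Fin d → ℕ+ =>
        expQuot ((d : ℝ) / 2 + s) ((c + a * ∑ i, ((k i : ℕ) : ℝ) ^ 2) * Δ)) ∧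
      |(∑' k : Fin d → ℕ+, expQuot ((d : ℝ) / 2 + s) ((c + a * ∑ i, ((k i : ℕ) : ℝ) ^ 2) * Δ))
        - ∫ y in Set.univ.pi fun _ : Fin d => Set.Ici (1 / 2),
          expQuot ((d : ℝ) / 2 + s) (a * Δ * ∑ i, y i ^ 2)|
        ≤ C * Δ ^ (1 - ((d : ℝ) / 2 + s)) := by
  obtain ⟨C, hC, h⟩ := abs_expQuot_shift_sub_setIntegral_le hd h0 h1 ha hc
  have hZ := summable_rpow_neg_sum_sq hd h0 h1
  set Z := ∑' k : Fin d → ℕ+, (∑ i, ((k i : ℕ) : ℝ) ^ 2) ^ (-((d : ℝ) / 2 + s)) with hZdef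
  have hZ0 : 0 ≤ Z := tsum_nonneg fun k => by positivity
  refine ⟨C * (Z + 1), by positivity, fun Δ hΔ => ?_⟩
  have hI := hasSum_setIntegral_unitCell hd h0 h1 (mul_pos ha hΔ)
  have hB := (hZ.hasSum.mul_left (C * Δ ^ (1 - ((d : ℝ) / 2 + s))))
  have hD := Summable.of_norm_bounded hB.summable (f := fun k : Fin d → ℕ+ =>
    expQuot ((d : ℝ) / 2 + s) ((c + a * ∑ i, ((k i : ℕ) : ℝ) ^ 2) * Δ)
      - ∫ y in unitCell (fun i => ((k i : ℕ) : ℝ)),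
        expQuot ((d : ℝ) / 2 + s) (a * Δ * ∑ i, y i ^ 2)) (fun k => h Δ hΔ k)
  have hS : Summable (fun k : Fin d → ℕ+ =>
      expQuot ((d : ℝ) / 2 + s) ((c + a * ∑ i, ((k i : ℕ) : ℝ) ^ 2) * Δ)) := by
    simpa using hD.add hI.summable
  refine ⟨hS, ?_⟩
  have hle := tsum_of_norm_bounded hB (f := fun k : Fin d → ℕ+ =>
    expQuot ((d : ℝ) / 2 + s) ((c + a * ∑ i, ((k i : ℕ) : ℝ) ^ 2) * Δ)
      - ∫ y in unitCell (fun i => ((k i : ℕ) : ℝ)),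
        expQuot ((d : ℝ) / 2 + s) (a * Δ * ∑ i, y i ^ 2)) (fun k => h Δ hΔ k)
  rw [hS.tsum_sub hI.summable, hI.tsum_eq, Real.norm_eq_abs] at hle
  refine hle.trans ?_
  have : 0 ≤ C * Δ ^ (1 - ((d : ℝ) / 2 + s)) := by positivity
  nlinarith

end RiemannSum

section Boxes

open scoped Pointwise

variable {d : ℕ}

/-- The points of the orthant whose `i`-th coordinate is below `r` exactly when `γ i` holds. -/
def orthantBox (γ : Fin d → Bool) (r : ℝ) : Set (Fin d → ℝ) :=
  {x | ∀ i, (γ i = true → 0 ≤ x i ∧ x i < r) ∧ (γ i = false → r ≤ x i)}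

lemma measurableSet_orthantBox (γ : Fin d → Bool) (r : ℝ) : MeasurableSet (orthantBox γ r) := by
  have : orthantBox γ r
      = Set.univ.pi fun i => if γ i = true then Set.Ico 0 r else Set.Ici r := by
    ext x
    simp only [orthantBox, Set.mem_ofPred_eq, Set.mem_pi, Set.mem_univ, true_imp_iff]
    refine forall_congr' fun i => ?_
    cases γ i <;> simp
  rw [this]
  refine MeasurableSet.univ_pi fun i => ?_
  split_ifs
  exacts [measurableSet_Ico, measurableSet_Ici]

lemma pairwise_disjoint_orthantBox (r : ℝ) :
    Pairwise (Function.onFun Disjoint fun γ : Fin d → Bool => orthantBox γ r) := by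
  intro γ γ' hne
  rw [Function.onFun, Set.disjoint_left]
  intro x hx hx'
  refine hne (funext fun i => ?_)
  have h := hx i
  have h' := hx' i
  cases hγ : γ i <;> cases hγ' : γ' i <;> try rfl
  · exact absurd (h.2 hγ) (not_le.2 (h'.1 hγ').2)
  · exact absurd (h'.2 hγ') (not_le.2 (h.1 hγ).2)

lemma iUnion_orthantBox {r : ℝ} (hr : 0 ≤ r) :
    ⋃ γ : Fin d → Bool, orthantBox γ r = Set.univ.pi fun _ => Set.Ici 0 := by
  ext x
  simp only [Set.mem_iUnion, orthantBox, Set.mem_ofPred_eq, Set.mem_pi, Set.mem_univ,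
    true_imp_iff, Set.mem_Ici]
  constructor
  · rintro ⟨γ, hγ⟩ i
    cases h : γ i
    · exact hr.trans ((hγ i).2 h)
    · exact ((hγ i).1 h).1
  · intro hx
    refine ⟨fun i => decide (x i < r), fun i => ⟨fun h => ⟨hx i, by simpa using h⟩, fun h => ?_⟩⟩
    simpa using h

lemma orthantBox_false (r : ℝ) :
    orthantBox (fun _ : Fin d => false) r = Set.univ.pi fun _ => Set.Ici r := by
  ext x
  simp [orthantBox, Set.mem_pi, -Set.pi_univ_Ici]

lemma orthantBox_true (r : ℝ) :
    orthantBox (fun _ : Fin d => true) r = Set.univ.pi fun _ => Set.Ico 0 r := by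
  ext x
  simp [orthantBox, Set.mem_pi, -Set.pi_univ_Ici]

lemma setIntegral_orthant_eq_add (hd : 1 ≤ d) {F : (Fin d → ℝ) → ℝ} (hF : Integrable F) {r : ℝ}
    (hr : 0 ≤ r) :
    ∫ x in Set.univ.pi fun _ : Fin d => Set.Ici (0 : ℝ), F x
      = (∑ γ ∈ Finset.univ.filter (fun γ : Fin d → Bool =>
              1 ≤ (Finset.univ.filter fun i => γ i = true).card ∧
                (Finset.univ.filter fun i => γ i = true).card ≤ d - 1),
          ∫ x in orthantBox γ r, F x)
        + (∫ x in Set.univ.pi fun _ : Fin d => Set.Ici r, F x)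
        + ∫ x in Set.univ.pi fun _ : Fin d => Set.Ico 0 r, F x := by
  rw [← iUnion_orthantBox hr, integral_iUnion_fintype (fun γ => measurableSet_orthantBox γ r)
    (pairwise_disjoint_orthantBox r) (fun _ => hF.integrableOn), ← orthantBox_false,
    ← orthantBox_true, ← Finset.sum_filter_add_sum_filter_not Finset.univ (fun γ : Fin d → Bool =>
              1 ≤ (Finset.univ.filter fun i => γ i = true).card ∧
                (Finset.univ.filter fun i => γ i = true).card ≤ d - 1), add_assoc]
  congr 1
  have hne : (fun _ : Fin d => false) ≠ fun _ => true := fun h => by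
    simpa using congrFun h ⟨0, hd⟩
  rw [← Finset.sum_pair (f := fun γ => ∫ x in orthantBox γ r, F x) hne]
  refine Finset.sum_congr ?_ fun _ _ => rfl
  ext γ
  simp only [Finset.mem_filter, Finset.mem_univ, true_and, Finset.mem_insert,
    Finset.mem_singleton]
  have hcard : (Finset.univ.filter fun i => γ i = true).card ≤ d := by
    simpa using Finset.card_filter_le (Finset.univ : Finset (Fin d)) (fun i => γ i = true)
  constructor
  · intro h
    have h' : (Finset.univ.filter fun i => γ i = true).card = 0 ∨
        (Finset.univ.filter fun i => γ i = true).card = d := by lia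
    rcases h' with h' | h'
    · left
      rw [Finset.card_eq_zero, Finset.filter_eq_empty_iff] at h'
      funext i
      simpa using h' (Finset.mem_univ i)
    · right
      have h2 := (Finset.card_filter_eq_iff (s := (Finset.univ : Finset (Fin d)))
        (p := fun i => γ i = true)).1 (by simpa using h')
      funext i
      exact h2 i (Finset.mem_univ i)
  · rintro (rfl | rfl)
    · simp
    · simp
      lia

lemma smul_univ_pi_Ici {h : ℝ} (hh : 0 < h) (r : ℝ) :
    h • (Set.univ.pi fun _ : Fin d => Set.Ici r) = Set.univ.pi fun _ => Set.Ici (h * r) := by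
  ext x
  simp only [Set.mem_smul_set_iff_inv_smul_mem₀ hh.ne', Set.mem_pi, Set.mem_univ, true_imp_iff,
    Set.mem_Ici, Pi.smul_apply, smul_eq_mul, le_inv_mul_iff₀ hh]

lemma smul_univ_pi_Ico {h : ℝ} (hh : 0 < h) (r : ℝ) :
    h • (Set.univ.pi fun _ : Fin d => Set.Ico 0 r) = Set.univ.pi fun _ => Set.Ico 0 (h * r) := by
  ext x
  simp only [Set.mem_smul_set_iff_inv_smul_mem₀ hh.ne', Set.mem_pi, Set.mem_univ, true_imp_iff,
    Set.mem_Ico, Pi.smul_apply, smul_eq_mul, inv_mul_lt_iff₀ hh, le_inv_mul_iff₀ hh, mul_zero]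

lemma rpow_mul_setIntegral_expQuot {p a Δ : ℝ} (hΔ : 0 < Δ) (S : Set (Fin d → ℝ)) :
    Δ ^ ((d : ℝ) / 2) * ∫ y in S, expQuot p (a * Δ * ∑ i, y i ^ 2)
      = ∫ z in Real.sqrt Δ • S, expQuot p (a * ∑ i, z i ^ 2) := by
  have hh : 0 < Real.sqrt Δ := Real.sqrt_pos.2 hΔ
  have h := Measure.setIntegral_comp_smul_of_pos (volume : Measure (Fin d → ℝ))
    (fun z => expQuot p (a * ∑ i, z i ^ 2)) S hh
  have hpow : Δ ^ ((d : ℝ) / 2) = Real.sqrt Δ ^ d := by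
    rw [Real.sqrt_eq_rpow, ← Real.rpow_natCast, ← Real.rpow_mul hΔ.le]
    ring_nf
  simp only [Pi.smul_apply, smul_eq_mul, mul_pow, Real.sq_sqrt hΔ.le, ← Finset.mul_sum,
    Module.finrank_fin_fun, ← mul_assoc] at h
  rw [h, hpow, ← mul_assoc, mul_inv_cancel₀ (by positivity), one_mul]

lemma expQuot_mul_le {p x X Δ : ℝ} (hx : 0 ≤ x) (hX : x ≤ X) (hΔ : 0 < Δ) :
    expQuot p (x * Δ) ≤ Δ ^ (1 - p) * Real.exp X * expQuot p x := by
  have hxX : x * Real.exp (-X) ≤ 1 - Real.exp (-x) := by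
    have h1 := Real.add_one_le_exp x
    have h2 : Real.exp x * Real.exp (-x) = 1 := by rw [← Real.exp_add]; simp
    have h3 : Real.exp (-X) ≤ Real.exp (-x) := Real.exp_le_exp.2 (by linarith)
    have h4 := Real.exp_pos (-x)
    nlinarith
  have hxX' : x ≤ Real.exp X * (1 - Real.exp (-x)) := by
    have h2 : Real.exp X * Real.exp (-X) = 1 := by rw [← Real.exp_add]; simp
    calc x = Real.exp X * (x * Real.exp (-X)) := by linear_combination (-x) * h2
      _ ≤ _ := by gcongr
  have hΔΔ : Δ ^ (1 - p) = Δ ^ (-p) * Δ := by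
    rw [← Real.rpow_add_one hΔ.ne']; ring_nf
  rw [expQuot_eq_mul p (by positivity), expQuot_eq_mul p hx, Real.mul_rpow hx hΔ.le, hΔΔ]
  calc _ ≤ (x * Δ) * (x ^ (-p) * Δ ^ (-p)) := by gcongr; exact one_sub_exp_neg_le _
    _ ≤ (Real.exp X * (1 - Real.exp (-x)) * Δ) * (x ^ (-p) * Δ ^ (-p)) := by gcongr
    _ = _ := by ring

/-- The integral over the small cube at the origin. -/
lemma abs_setIntegral_cube_expQuot_le {s a : ℝ} (hd : 1 ≤ d) (h0 : 0 < s) (h1 : s < 1)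
    (ha : 0 < a) :
    ∃ C > 0, ∀ Δ > 0,
      |∫ z in Set.univ.pi fun _ : Fin d => Set.Ico 0 (Real.sqrt Δ / 2),
        expQuot ((d : ℝ) / 2 + s) (a * ∑ i, z i ^ 2)| ≤ C * Δ ^ (1 - s) := by
  set p := (d : ℝ) / 2 + s with hp
  set S : Set (Fin d → ℝ) := Set.univ.pi fun _ => Set.Ico 0 (1 / 2) with hS
  have hSm : MeasurableSet S := MeasurableSet.univ_pi fun _ => measurableSet_Ico
  set I := ∫ y in S, expQuot p (a * ∑ i, y i ^ 2) with hI
  have hI0 : 0 ≤ I := integral_nonneg fun y => expQuot_nonneg p (by positivity)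
  refine ⟨Real.exp (a * d) * I + 1, by positivity, fun Δ hΔ => ?_⟩
  have hscale := rpow_mul_setIntegral_expQuot (d := d) (p := p) (a := a) hΔ S
  rw [hS, smul_univ_pi_Ico (Real.sqrt_pos.2 hΔ), mul_one_div, ← hS] at hscale
  rw [← hscale, abs_of_nonneg (mul_nonneg (by positivity)
    (integral_nonneg fun y => expQuot_nonneg p (by positivity)))]
  have hmono : ∫ y in S, expQuot p (a * Δ * ∑ i, y i ^ 2)
      ≤ ∫ y in S, Δ ^ (1 - p) * Real.exp (a * d) * expQuot p (a * ∑ i, y i ^ 2) := by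
    refine setIntegral_mono_on (integrable_expQuot_sum_sq hd h0 h1 (mul_pos ha hΔ)).integrableOn
      ((integrable_expQuot_sum_sq hd h0 h1 ha).integrableOn.const_mul _) hSm fun y hy => ?_
    rw [show a * Δ * ∑ i, y i ^ 2 = a * (∑ i, y i ^ 2) * Δ by ring]
    refine expQuot_mul_le (by positivity) ?_ hΔ
    gcongr
    calc ∑ i, y i ^ 2 ≤ ∑ _i : Fin d, (1 : ℝ) := Finset.sum_le_sum fun i _ => by
          have := hy i trivial
          nlinarith [this.1, this.2]
      _ = d := by simp
  rw [integral_const_mul] at hmono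
  have hexp : Δ ^ ((d : ℝ) / 2) * Δ ^ (1 - p) = Δ ^ (1 - s) := by
    rw [← Real.rpow_add hΔ, hp]; ring_nf
  calc _ ≤ Δ ^ ((d : ℝ) / 2) * (Δ ^ (1 - p) * Real.exp (a * d) * I) := by gcongr
    _ = Real.exp (a * d) * I * Δ ^ (1 - s) := by rw [← hexp]; ring
    _ ≤ _ := by
      gcongr
      linarith

end Boxes

/-- for `f_α(x) = (1−e^{−x})/x^{1+α}` with `α = d/2 − 1 + α'`, `α' ∈ (0,1)`,
one has, for all sufficiently small `Δ > 0`,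
`|Δ^{d/2} Σ_{k ∈ (ℕ_{≥1})^d} f_α(λ_k Δ) − Γ(1−α')/(2^d (πη)^{d/2} α' Γ(d/2))
  + Σ_{γ, 1 ≤ ‖γ‖₁ ≤ d−1} ∫_{B_γ(Δ)} f_α(π²η‖z‖²) dz| ≤ C Δ^{1−α'}`. -/
theorem stmt14 (d : ℕ) (hd : 2 ≤ d) (η ϑ0 : ℝ) (hη : 0 < η) (ν : Fin d → ℝ)
    (hpos : 0 < -ϑ0 + (∑ l, ν l ^ 2 / (4 * η)) + Real.pi ^ 2 * η * d)
    (α' α : ℝ) (h0 : 0 < α') (h1 : α' < 1) (hα : α = (d : ℝ) / 2 - 1 + α')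
    (f : ℝ → ℝ) (hf : f = fun x : ℝ => (1 - Real.exp (-x)) / x ^ (1 + α)) :
    ∃ C > 0, ∃ Δ₀ ∈ Set.Ioo (0 : ℝ) 1, ∀ Δ ∈ Set.Ioc (0 : ℝ) Δ₀,
      Summable (fun k : Fin d → ℕ+ =>
        f ((-ϑ0 + ∑ l, (ν l ^ 2 / (4 * η) + Real.pi ^ 2 * ((k l : ℕ) : ℝ) ^ 2 * η)) * Δ)) ∧
      |Δ ^ ((d : ℝ) / 2) *
            (∑' k : Fin d → ℕ+,
              f ((-ϑ0 + ∑ l, (ν l ^ 2 / (4 * η) + Real.pi ^ 2 * ((k l : ℕ) : ℝ) ^ 2 * η)) * Δ))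
          - Real.Gamma (1 - α') /
              (2 ^ d * (Real.pi * η) ^ ((d : ℝ) / 2) * α' * Real.Gamma ((d : ℝ) / 2))
          + ∑ γ ∈ Finset.univ.filter (fun γ : Fin d → Bool =>
              1 ≤ (Finset.univ.filter fun i => γ i = true).card ∧
                (Finset.univ.filter fun i => γ i = true).card ≤ d - 1),
              ∫ z in {x : Fin d → ℝ | ∀ i,
                  (γ i = true → 0 ≤ x i ∧ x i < Real.sqrt Δ / 2) ∧
                    (γ i = false → Real.sqrt Δ / 2 ≤ x i)},
                f (Real.pi ^ 2 * η * ∑ i, z i ^ 2)| ≤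
        C * Δ ^ (1 - α') := by
  have hd1 : 1 ≤ d := by lia
  have ha : 0 < Real.pi ^ 2 * η := mul_pos (pow_pos Real.pi_pos 2) hη
  have hfe : f = expQuot ((d : ℝ) / 2 + α') := by
    rw [hf, hα]
    funext x
    rw [expQuot]
    ring_nf
  subst hfe
  obtain ⟨C₁, hC₁, hsum⟩ := abs_tsum_expQuot_sub_setIntegral_le hd1 h0 h1 ha hpos
  obtain ⟨C₂, hC₂, hcube⟩ := abs_setIntegral_cube_expQuot_le hd1 h0 h1 ha
  have hlam : ∀ k : Fin d → ℕ+,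
      -ϑ0 + ∑ l, (ν l ^ 2 / (4 * η) + Real.pi ^ 2 * ((k l : ℕ) : ℝ) ^ 2 * η)
        = -ϑ0 + (∑ l, ν l ^ 2 / (4 * η)) + Real.pi ^ 2 * η * ∑ i, ((k i : ℕ) : ℝ) ^ 2 := by
    intro k
    rw [Finset.sum_add_distrib, Finset.mul_sum, add_assoc]
    congr 2
    exact Finset.sum_congr rfl fun i _ => by ring
  refine ⟨C₁ + C₂, by positivity, 1 / 2, by norm_num, fun Δ hΔ => ?_⟩
  have hΔ0 : 0 < Δ := hΔ.1
  obtain ⟨hS, hSI⟩ := hsum Δ hΔ0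
  have hcubeΔ := hcube Δ hΔ0
  simp only [hlam]
  refine ⟨hS, ?_⟩
  have hscale := rpow_mul_setIntegral_expQuot (d := d) (p := (d : ℝ) / 2 + α')
    (a := Real.pi ^ 2 * η) hΔ0 (Set.univ.pi fun _ : Fin d => Set.Ici (1 / 2))
  rw [smul_univ_pi_Ici (Real.sqrt_pos.2 hΔ0), mul_one_div] at hscale
  have hdec := setIntegral_orthant_eq_add hd1 (integrable_expQuot_sum_sq hd1 h0 h1 ha)
    (by positivity : 0 ≤ Real.sqrt Δ / 2)
  rw [setIntegral_orthant_expQuot_sum_sq hd1 h0 h1 hη, ← hscale] at hdec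
  simp only [orthantBox] at hdec
  have hexp : Δ ^ ((d : ℝ) / 2) * Δ ^ (1 - ((d : ℝ) / 2 + α')) = Δ ^ (1 - α') := by
    rw [← Real.rpow_add hΔ0]; ring_nf
  have hX : 0 ≤ Δ ^ ((d : ℝ) / 2) := by positivity
  have hmain := mul_le_mul_of_nonneg_left hSI hX
  rw [← abs_of_nonneg hX, ← abs_mul, abs_of_nonneg hX] at hmain
  rw [hdec]
  refine le_trans (le_of_eq ?_) ((abs_sub _ _).trans (add_le_add hmain hcubeΔ)) |>.trans_eq ?_
  · congr 1
    ring
  · rw [← hexp]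
    ring
end
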